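/- arXiv:2101.00487 — 2 statements merged into one kernel-verified Lean document; each statement's English description precedes it below -/
import Mathlib

section
/- The set of tuples (g₁,…,g_s) ∈ GL_r(ℂ)^s such that g₁,…,g_s and the product g₁⋯g_s are all diagonalizable with root-of-unity eigenvalues is Zariski dense in GL_r(ℂ)^s. -/
open MvPolynomial

/-- `g ∈ GL_r(ℂ)` is diagonalizable with root-of-unity eigenvalues. -/
def DiagonalizableWithRootOfUnityEigenvalues {r : ℕ} (g : GL (Fin r) ℂ) : Prop :=
  ∃ (P : GL (Fin r) ℂ) (d : Fin r → ℂ), (∀ k, ∃ n : ℕ, 0 < n ∧ d k ^ n = 1) ∧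
    (g : Matrix (Fin r) (Fin r) ℂ) =
      (P : Matrix (Fin r) (Fin r) ℂ) * Matrix.diagonal d * (P⁻¹ : GL (Fin r) ℂ)

/-- Evaluation of a tuple in `GL_r(ℂ)^s` as a point of affine space `(M_r(ℂ) × ℂ)^s`,
recording the matrix entries and the inverse determinants. -/
noncomputable def glPoint {r s : ℕ} (g : Fin s → GL (Fin r) ℂ) :
    (Fin s × Fin r × Fin r) ⊕ Fin s → ℂ :=
  Sum.elim (fun p => (g p.1 : Matrix (Fin r) (Fin r) ℂ) p.2.1 p.2.2)
    (fun i => ((g i : Matrix (Fin r) (Fin r) ℂ).det)⁻¹)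

/-- A constructible subset of the spectrum of a domain or its complement contains a nonempty basic
open set, according to whether it contains the generic point. -/
theorem PrimeSpectrum.exists_basicOpen_subset_of_isConstructible {A : Type*} [CommRing A]
    [IsDomain A] {s : Set (PrimeSpectrum A)} (hs : Topology.IsConstructible s) :
    (⊥ ∈ s → ∃ a : A, a ≠ 0 ∧ (basicOpen a : Set (PrimeSpectrum A)) ⊆ s) ∧
      (⊥ ∉ s → ∃ a : A, a ≠ 0 ∧ (basicOpen a : Set (PrimeSpectrum A)) ⊆ sᶜ) := by
  induction hs using Topology.IsConstructible.empty_union_induction with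
  | open_retrocompact U hU _ =>
    have key : ∀ x ∈ U, ∃ a : A, a ≠ 0 ∧ x ∈ basicOpen a ∧
        (basicOpen a : Set (PrimeSpectrum A)) ⊆ U := by
      intro x hx
      obtain ⟨_, ⟨a, rfl⟩, hxa, ha⟩ :=
        isTopologicalBasis_basic_opens.exists_subset_of_mem_open hx hU
      refine ⟨a, ?_, hxa, ha⟩
      rintro rfl
      simp at hxa
    refine ⟨fun h => ?_, fun h => ⟨1, one_ne_zero, fun x _ hx => ?_⟩⟩
    · obtain ⟨a, h0, -, ha⟩ := key _ h
      exact ⟨a, h0, ha⟩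
    · obtain ⟨a, h0, -, ha⟩ := key x hx
      exact h (ha (by simpa [mem_basicOpen] using h0))
  | union s _ t _ ihs iht =>
    refine ⟨?_, fun h => ?_⟩
    · rintro (h | h)
      · obtain ⟨a, h0, ha⟩ := ihs.1 h
        exact ⟨a, h0, ha.trans Set.subset_union_left⟩
      · obtain ⟨a, h0, ha⟩ := iht.1 h
        exact ⟨a, h0, ha.trans Set.subset_union_right⟩
    · simp only [Set.mem_union, not_or] at h
      obtain ⟨a, h0, ha⟩ := ihs.2 h.1
      obtain ⟨b, h0', hb⟩ := iht.2 h.2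
      refine ⟨a * b, mul_ne_zero h0 h0', ?_⟩
      rw [basicOpen_mul, Set.compl_union]
      exact Set.inter_subset_inter ha hb
  | compl s _ ih =>
    refine ⟨fun h => ih.2 h, fun h => ?_⟩
    rw [compl_compl]
    exact ih.1 (by simpa using h)

/-- If `φ` is a dominant polynomial map between affine spaces over an algebraically closed field,
then the image of any nonempty basic open set contains a nonempty basic open set. -/
theorem MvPolynomial.exists_forall_eval_ne_zero_of_injective {K σ τ : Type*} [Field K]
    [IsAlgClosed K] [Finite σ] [Finite τ] (φ : τ → MvPolynomial σ K)
    (hφ : Function.Injective (aeval φ : MvPolynomial τ K →ₐ[K] MvPolynomial σ K))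
    {b : MvPolynomial σ K} (hb : b ≠ 0) :
    ∃ a : MvPolynomial τ K, a ≠ 0 ∧ ∀ c : τ → K, eval c a ≠ 0 →
      ∃ x : σ → K, (∀ j, eval x (φ j) = c j) ∧ eval x b ≠ 0 := by
  set f : MvPolynomial τ K →ₐ[K] MvPolynomial σ K := aeval φ with hf
  have hfin : (f : MvPolynomial τ K →+* MvPolynomial σ K).FinitePresentation := by
    rw [RingHom.FinitePresentation.of_finiteType.symm]
    refine RingHom.FiniteType.of_comp_finiteType (f := C) ?_
    have : (f : MvPolynomial τ K →+* MvPolynomial σ K).comp C =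
        algebraMap K (MvPolynomial σ K) := by
      ext x; simp [f]
    rw [this, RingHom.finiteType_algebraMap]
    infer_instance
  have hc := PrimeSpectrum.isConstructible_comap_image hfin
    (PrimeSpectrum.isConstructible_basicOpen (f := b))
  have hmem : (⊥ : PrimeSpectrum (MvPolynomial τ K)) ∈
      PrimeSpectrum.comap (f : MvPolynomial τ K →+* MvPolynomial σ K) ''
        (PrimeSpectrum.basicOpen b) := by
    refine ⟨⊥, by simpa [PrimeSpectrum.mem_basicOpen] using hb, ?_⟩
    ext x
    simpa using map_eq_zero_iff f hφ
  obtain ⟨a, ha, hsub⟩ := (PrimeSpectrum.exists_basicOpen_subset_of_isConstructible hc).1 hmem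
  refine ⟨a, ha, fun c hca => ?_⟩
  let m : PrimeSpectrum (MvPolynomial τ K) := ⟨RingHom.ker (eval c), RingHom.ker_isPrime _⟩
  obtain ⟨q, hqb, hq⟩ := hsub (show m ∈ PrimeSpectrum.basicOpen a from hca)
  have hrad := vanishingIdeal_zeroLocus_eq_radical (K := K) q.asIdeal
  rw [q.isPrime.radical] at hrad
  have hb' : b ∉ vanishingIdeal K (zeroLocus K q.asIdeal) := by
    rw [hrad]; exact hqb
  simp only [mem_vanishingIdeal_iff, not_forall] at hb'
  obtain ⟨x, hx, hxb⟩ := hb'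
  refine ⟨x, fun j => ?_, by simpa [aeval_eq_eval] using hxb⟩
  have h1 : (X j - C (c j) : MvPolynomial τ K) ∈ m.asIdeal := by
    simp [m, RingHom.mem_ker]
  rw [← hq] at h1
  have h2 := hx _ h1
  simpa [f, sub_eq_zero, aeval_eq_eval] using h2

/-- Denominators coming from a finite family of polynomials can be cleared. -/
theorem MvPolynomial.exists_eval_sumElim_inv_mul_prod_pow {K σ κ : Type*} [Field K] [Fintype κ]
    (D : κ → MvPolynomial σ K) (F : MvPolynomial (σ ⊕ κ) K) :
    ∃ (N : ℕ) (G : MvPolynomial σ K), ∀ x : σ → K, (∀ i, eval x (D i) ≠ 0) →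
      eval x G = eval (Sum.elim x fun i => (eval x (D i))⁻¹) F * (∏ i, eval x (D i)) ^ N := by
  classical
  induction F using MvPolynomial.induction_on with
  | C a => exact ⟨0, C a, fun x _ => by simp⟩
  | add p q hp hq =>
    obtain ⟨N, G, h⟩ := hp
    obtain ⟨M, H, h'⟩ := hq
    refine ⟨N + M, G * (∏ i, D i) ^ M + H * (∏ i, D i) ^ N, fun x hx => ?_⟩
    simp only [map_add, map_mul, map_pow, map_prod, h x hx, h' x hx]
    ring
  | mul_X p j hp =>
    obtain ⟨N, G, h⟩ := hp
    cases j with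
    | inl j => exact ⟨N, G * X j, fun x hx => by simp [h x hx]; ring⟩
    | inr j =>
      refine ⟨N + 1, G * ∏ i ∈ Finset.univ.erase j, D i, fun x hx => ?_⟩
      have h1 := Finset.mul_prod_erase Finset.univ (fun i => eval x (D i)) (Finset.mem_univ j)
      simp only [map_mul, map_prod, h x hx, eval_X, Sum.elim_inr]
      rw [pow_succ, ← h1]
      field_simp [hx j]

/-- A nonzero complex polynomial does not vanish at some tuple of roots of unity. -/
theorem MvPolynomial.exists_rootsOfUnity_eval_ne_zero {τ : Type*} {G : MvPolynomial τ ℂ}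
    (hG : G ≠ 0) : ∃ u : τ → ℂ, (∀ j, ∃ N : ℕ, 0 < N ∧ u j ^ N = 1) ∧ eval u G ≠ 0 := by
  have hinf : {z : ℂ | ∃ N : ℕ, 0 < N ∧ z ^ N = 1}.Infinite := by
    intro hfin
    have hinj : Function.Injective fun k : ℕ =>
        Complex.exp (2 * Real.pi * Complex.I / (k + 1 : ℕ)) := by
      intro k l hkl
      have hk := (Complex.isPrimitiveRoot_exp (k + 1) k.succ_ne_zero).eq_orderOf
      have hl := (Complex.isPrimitiveRoot_exp (l + 1) l.succ_ne_zero).eq_orderOf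
      have : k + 1 = l + 1 := by
        rw [hk, hl]; exact congrArg orderOf hkl
      omega
    refine Set.infinite_of_injective_forall_mem hinj (fun k => ?_) hfin
    exact ⟨k + 1, k.succ_pos, (Complex.isPrimitiveRoot_exp (k + 1) k.succ_ne_zero).pow_eq_one⟩
  by_contra! h
  exact hG (funext_set (fun _ => {z : ℂ | ∃ N : ℕ, 0 < N ∧ z ^ N = 1}) (fun _ => hinf)
    fun u hu => by rw [map_zero]; exact h u fun j => hu j trivial)

open scoped Matrix in
/-- A matrix whose characteristic polynomial has distinct roots `d` is conjugate to
`diagonal d`. -/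
theorem Matrix.exists_eq_conj_diagonal_of_charpoly_eq_prod {K ι : Type*} [Field K] [Fintype ι]
    [DecidableEq ι] (M : Matrix ι ι K) {d : ι → K} (hd : Function.Injective d)
    (hM : M.charpoly = ∏ k, (Polynomial.X - Polynomial.C (d k))) :
    ∃ P : GL ι K, M = (P : Matrix ι ι K) * diagonal d * (P⁻¹ : GL ι K) := by
  have hev : ∀ k, ∃ v, Module.End.HasEigenvector (Matrix.toLin' M) (d k) v := fun k => by
    apply Module.End.HasEigenvalue.exists_hasEigenvector
    rw [Module.End.hasEigenvalue_iff_isRoot_charpoly, Matrix.charpoly_toLin', hM,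
      Polynomial.IsRoot, Polynomial.eval_prod]
    exact Finset.prod_eq_zero (Finset.mem_univ k) (by simp)
  choose v hv using hev
  have hli := Module.End.eigenvectors_linearIndependent' _ d hd v hv
  have hunit : IsUnit (Matrix.of v)ᵀ := by
    rw [← Matrix.linearIndependent_cols_iff_isUnit]
    exact hli
  obtain ⟨P, hP⟩ := hunit
  refine ⟨P, ?_⟩
  have h : M * (P : Matrix ι ι K) = (P : Matrix ι ι K) * diagonal d := by
    ext i k
    have := congrFun (hv k).apply_eq_smul i
    rw [hP, Matrix.mul_diagonal]
    simpa [Matrix.mul_apply, Matrix.mulVec, dotProduct, mul_comm] using this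
  rw [← h, mul_assoc, Units.mul_inv, mul_one]

open Polynomial Matrix in
/-- There are a lower and an upper triangular matrix with given nonzero diagonals whose product has
prescribed distinct eigenvalues, subject to the determinant condition. -/
theorem Matrix.exists_triangular_mul_charpoly_eq {K : Type*} [Field K] {n : ℕ}
    {a b μ : Fin (n + 1) → K} (ha : ∀ k, a k ≠ 0) (hb : ∀ k, b k ≠ 0)
    (hμ : Function.Injective μ) (hprod : (∏ k, a k) * ∏ k, b k = ∏ k, μ k) :
    ∃ A B : Matrix (Fin (n + 1)) (Fin (n + 1)) K, Aᵀ.IsUpperTriangular ∧ (∀ k, A k k = a k) ∧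
      B.IsUpperTriangular ∧ (∀ k, B k k = b k) ∧
      (A * B).charpoly = ∏ k, (Polynomial.X - Polynomial.C (μ k)) := by
  let A : Matrix (Fin (n + 1)) (Fin (n + 1)) K := .of fun i j =>
    if i = j then a j else if (i : ℕ) = j + 1 then (b j)⁻¹ else 0
  have hAt : Aᵀ.IsUpperTriangular := by
    intro i j hij
    have hij : j < i := hij
    have h1 : j ≠ i := hij.ne
    have h2 : (j : ℕ) ≠ i + 1 := by have : (j : ℕ) < i := hij; omega
    simp [A, h1, h2]
  have hAd : ∀ k, A k k = a k := fun k => by simp [A]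
  have hAdet : A.det = ∏ k, a k := by
    rw [← Matrix.det_transpose, Matrix.det_of_isUpperTriangular hAt]
    exact Finset.prod_congr rfl fun k _ => hAd k
  have hAu : IsUnit A.det := by
    rw [hAdet]; exact (Finset.prod_ne_zero_iff.2 fun k _ => ha k).isUnit
  let p : Fin (n + 1) → K[X] := fun j =>
    ∏ l ∈ Finset.Iio j, (Polynomial.X - Polynomial.C (a l * b l))
  have hpm : ∀ j, (p j).Monic := fun j => monic_prod_of_monic _ _ fun l _ => monic_X_sub_C _
  have hpd : ∀ j, (p j).natDegree = j := fun j => by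
    rw [natDegree_prod_of_monic _ _ fun l _ => monic_X_sub_C _]
    simp only [natDegree_X_sub_C]
    simp
  have hps : ∀ j : Fin n, p j.succ =
      p j.castSucc * (Polynomial.X - Polynomial.C (a j.castSucc * b j.castSucc)) := by
    intro j
    have : Finset.Iio j.succ = insert j.castSucc (Finset.Iio j.castSucc) := by
      ext l
      simp only [Finset.mem_Iio, Finset.mem_insert, Fin.lt_def, Fin.ext_iff, Fin.val_succ,
        Fin.val_castSucc]
      omega
    simp only [p]
    rw [this, Finset.prod_insert (by simp), mul_comm]
  let N : Matrix (Fin (n + 1)) (Fin (n + 1)) K := .of fun k j => (p j).eval (μ k)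
  have hNu : IsUnit N.det := by
    rw [← Matrix.det_eval_matrixOfPolynomials_eq_det_vandermonde μ p hpd hpm]
    exact (Matrix.det_vandermonde_ne_zero_iff.2 hμ).isUnit
  let M := N⁻¹ * diagonal μ * N
  have hcol : ∀ (j : Fin n) k, (N * A) k j.castSucc * b j.castSucc = μ k * N k j.castSucc := by
    intro j k
    have hA : ∀ i, A i j.castSucc = (if i = j.castSucc then a j.castSucc else 0) +
        (if i = j.succ then (b j.castSucc)⁻¹ else 0) := by
      intro i
      have h1 : ((i : ℕ) = j + 1) ↔ i = j.succ := by simp [Fin.ext_iff]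
      have h2 : j.castSucc ≠ j.succ := (Fin.castSucc_lt_succ).ne
      by_cases h : i = j.castSucc
      · subst h; simp [A, h2]
      · simp [A, h, h1]
    have hb' := hb j.castSucc
    simp only [Matrix.mul_apply, hA, mul_add, mul_ite, mul_zero, Finset.sum_add_distrib,
      Finset.sum_ite_eq', Finset.mem_univ, if_true]
    simp only [N, Matrix.of_apply, hps, Polynomial.eval_mul, Polynomial.eval_sub,
      Polynomial.eval_X, Polynomial.eval_C]
    field_simp
    ring
  let B := A⁻¹ * M
  have hNAB : N * A * B = diagonal μ * N := by
    simp only [B, M]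
    rw [mul_assoc, Matrix.mul_nonsing_inv_cancel_left _ _ hAu, mul_assoc,
      Matrix.mul_nonsing_inv_cancel_left _ _ hNu]
  have hAB : A * B = M := Matrix.mul_nonsing_inv_cancel_left _ _ hAu
  have hNAu : IsUnit (N * A).det := by rw [Matrix.det_mul]; exact hNu.mul hAu
  have hBcol : ∀ (j : Fin n) i, B i j.castSucc = if i = j.castSucc then b j.castSucc else 0 := by
    intro j
    have h : (N * A) *ᵥ (fun i => B i j.castSucc) =
        (N * A) *ᵥ (fun i => if i = j.castSucc then b j.castSucc else 0) := by
      ext k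
      have h1 := congrFun (congrFun hNAB k) j.castSucc
      rw [Matrix.diagonal_mul, ← hcol] at h1
      simpa [Matrix.mulVec, dotProduct, Matrix.mul_apply (M := N * A)] using h1
    exact congrFun (Matrix.mulVec_injective_of_isUnit ((Matrix.isUnit_iff_isUnit_det _).2 hNAu) h)
  have hBt : B.IsUpperTriangular := by
    intro i j hij
    have hij : j < i := hij
    obtain ⟨j, rfl⟩ := Fin.exists_castSucc_eq.2 (hij.trans_le (Fin.le_last i)).ne
    rw [hBcol, if_neg hij.ne']
  have hMch : M.charpoly = ∏ k, (Polynomial.X - Polynomial.C (μ k)) := by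
    have h := Matrix.charpoly_units_conj' (N.nonsingInvUnit hNu) (diagonal μ)
    rw [Matrix.charpoly_diagonal] at h
    rw [← h]
    rfl
  have hMdet : M.det = ∏ k, μ k := by
    simp only [M]
    rw [Matrix.det_conj' ((Matrix.isUnit_iff_isUnit_det _).2 hNu), Matrix.det_diagonal]
  refine ⟨A, B, hAt, hAd, hBt, fun k => ?_, hAB ▸ hMch⟩
  induction k using Fin.lastCases with
  | cast j => simp [hBcol]
  | last =>
    have h : A.det * B.det = ∏ k, μ k := by rw [← Matrix.det_mul, hAB, hMdet]
    rw [Matrix.det_of_isUpperTriangular hBt, hAdet, ← hprod] at h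
    have h' := mul_left_cancel₀ (Finset.prod_ne_zero_iff.2 fun k _ => ha k) h
    rw [Fin.prod_univ_castSucc, Fin.prod_univ_castSucc] at h'
    simp only [hBcol, if_true] at h'
    exact mul_left_cancel₀ (Finset.prod_ne_zero_iff.2 fun k _ => hb _) h'

open Polynomial Matrix in
/-- Tuples of at least two matrices realize all characteristic polynomials of the entries and of
the product, subject to the determinant condition, if the eigenvalues of the entries are nonzero
and those of the product are distinct. -/
theorem Matrix.exists_tuple_charpoly_eq {K : Type*} [Field K] {n m : ℕ}
    {l : Fin (m + 2) → Fin (n + 1) → K} {μ : Fin (n + 1) → K} (hl : ∀ i k, l i k ≠ 0)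
    (hμ : Function.Injective μ) (hprod : ∏ i, ∏ k, l i k = ∏ k, μ k) :
    ∃ Y : Fin (m + 2) → Matrix (Fin (n + 1)) (Fin (n + 1)) K,
      (∀ i, (Y i).charpoly = ∏ k, (Polynomial.X - Polynomial.C (l i k))) ∧
      (List.ofFn Y).prod.charpoly = ∏ k, (Polynomial.X - Polynomial.C (μ k)) := by
  let e : Fin (n + 1) → K := fun k => ∏ i : Fin m, l i.succ.succ k
  have he : ∀ k, e k ≠ 0 := fun k => Finset.prod_ne_zero_iff.2 fun i _ => hl _ _
  obtain ⟨A, B, hAt, hAd, hBt, hBd, hAB⟩ := Matrix.exists_triangular_mul_charpoly_eq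
    (a := l 0) (b := fun k => l 1 k * e k) (hl 0) (fun k => mul_ne_zero (hl 1 k) (he k)) hμ (by
      rw [← hprod, Finset.prod_mul_distrib, Finset.prod_comm,
        Fin.prod_univ_succ (fun i => ∏ k, l i k), Fin.prod_univ_succ (fun i => ∏ k, l i.succ k)]
      rfl)
  let B' : Matrix (Fin (n + 1)) (Fin (n + 1)) K := B * diagonal e⁻¹
  have hB'e : ∀ i j, B' i j = B i j * (e j)⁻¹ := fun i j => Matrix.mul_diagonal _ _ _ _
  have hB' : B'.IsUpperTriangular := by
    intro i j hij
    rw [hB'e, hBt hij, zero_mul]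
  refine ⟨Fin.cons A (Fin.cons B' fun i => diagonal (l i.succ.succ)), fun i => ?_, ?_⟩
  · refine Fin.cases ?_ (fun i => Fin.cases ?_ (fun i => ?_) i) i
    · rw [Fin.cons_zero, ← Matrix.charpoly_transpose, Matrix.charpoly_of_isUpperTriangular _ hAt]
      simp [hAd]
    · rw [Fin.cons_succ, Fin.cons_zero, Matrix.charpoly_of_isUpperTriangular _ hB']
      refine Finset.prod_congr rfl fun k _ => ?_
      rw [hB'e, hBd, mul_inv_cancel_right₀ (he k)]
      rfl
    · rw [Fin.cons_succ, Fin.cons_succ, Matrix.charpoly_diagonal]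
  · have hdiag : (List.ofFn fun i : Fin m => diagonal (l i.succ.succ)).prod = diagonal e := by
      have h := map_list_prod (Matrix.diagonalRingHom (Fin (n + 1)) K)
        (List.ofFn fun i : Fin m => l i.succ.succ)
      rw [List.prod_ofFn, List.map_ofFn] at h
      refine h.symm.trans (congrArg diagonal ?_)
      ext k; simp [e]
    rw [List.ofFn_succ, List.prod_cons, List.ofFn_succ, List.prod_cons]
    simp only [Fin.cons_zero, Fin.cons_succ]
    rw [hdiag, ← hAB]
    congr 2
    rw [mul_assoc, Matrix.diagonal_mul_diagonal]
    have : (fun k => e⁻¹ k * e k) = 1 := by ext k; simp [he k]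
    rw [this, Matrix.diagonal_one', mul_one]

section CharData

variable {R S : Type*} [CommRing R] [CommRing S] {n s m : ℕ}

/-- The `i`-th matrix of a tuple given by its entries. -/
def tupleMatrix (x : Fin s × Fin (n + 1) × Fin (n + 1) → R) (i : Fin s) :
    Matrix (Fin (n + 1)) (Fin (n + 1)) R :=
  .of fun a b => x (i, a, b)

/-- The non-leading coefficients of the characteristic polynomials of the matrices of a tuple,
and the non-leading, non-constant coefficients of the characteristic polynomial of their product. -/
noncomputable def tupleCharData (x : Fin s × Fin (n + 1) × Fin (n + 1) → R) :
    (Fin s × Fin (n + 1)) ⊕ Fin n → R :=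
  Sum.elim (fun p => (tupleMatrix x p.1).charpoly.coeff p.2)
    fun k => (List.ofFn (tupleMatrix x)).prod.charpoly.coeff (k + 1)

/-- Eigenvalues of the matrices of a tuple, in terms of the free parameters `u`. -/
def tupleEigenvalue (u : (Fin (m + 1) × Fin (n + 1)) ⊕ Fin n → R) (i : Fin (m + 1))
    (k : Fin (n + 1)) : R :=
  u (.inl (i, k)) * if (i, k) = (0, 0) then ∏ j, u (.inr j) else 1

/-- Eigenvalues of the product of a tuple of matrices, in terms of the free parameters `u`. -/
def prodEigenvalue (u : (Fin (m + 1) × Fin (n + 1)) ⊕ Fin n → R) : Fin (n + 1) → R :=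
  Fin.cons (∏ p, u (.inl p)) fun j => u (.inr j)

/-- The values of `tupleCharData` on tuples with eigenvalues given by `tupleEigenvalue` and
`prodEigenvalue`. -/
noncomputable def eigenvalueCharData (u : (Fin (m + 1) × Fin (n + 1)) ⊕ Fin n → R) :
    (Fin (m + 1) × Fin (n + 1)) ⊕ Fin n → R :=
  Sum.elim (fun p => (∏ l, (Polynomial.X - Polynomial.C (tupleEigenvalue u p.1 l))).coeff p.2)
    fun k => (∏ l, (Polynomial.X - Polynomial.C (prodEigenvalue u l))).coeff (k + 1)

/-- The product of the parameters and of all the differences of the eigenvalues. -/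
def eigenvalueDiscr (u : (Fin (m + 1) × Fin (n + 1)) ⊕ Fin n → R) : R :=
  (∏ j, u j) *
    (∏ i, ∏ p ∈ Finset.univ.offDiag, (tupleEigenvalue u i p.1 - tupleEigenvalue u i p.2)) *
      ∏ p ∈ Finset.univ.offDiag, (prodEigenvalue u p.1 - prodEigenvalue u p.2)

theorem tupleMatrix_map (f : R →+* S) (x : Fin s × Fin (n + 1) × Fin (n + 1) → R) (i : Fin s) :
    tupleMatrix (f ∘ x) i = f.mapMatrix (tupleMatrix x i) :=
  rfl

theorem tupleCharData_map (f : R →+* S) (x : Fin s × Fin (n + 1) × Fin (n + 1) → R) (j) :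
    tupleCharData (f ∘ x) j = f (tupleCharData x j) := by
  cases j with
  | inl p =>
    simp only [tupleCharData, Sum.elim_inl, tupleMatrix_map]
    rw [RingHom.mapMatrix_apply, Matrix.charpoly_map, Polynomial.coeff_map]
  | inr k =>
    have h : tupleMatrix (f ∘ x) = f.mapMatrix ∘ tupleMatrix x := rfl
    simp only [tupleCharData, Sum.elim_inr]
    rw [h, ← List.map_ofFn, ← map_list_prod, RingHom.mapMatrix_apply, Matrix.charpoly_map,
      Polynomial.coeff_map]

theorem tupleEigenvalue_map (f : R →+* S) (u : (Fin (m + 1) × Fin (n + 1)) ⊕ Fin n → R) (i k) :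
    tupleEigenvalue (f ∘ u) i k = f (tupleEigenvalue u i k) := by
  simp only [tupleEigenvalue, Function.comp_apply, map_mul]
  split_ifs <;> simp

theorem prodEigenvalue_map (f : R →+* S) (u : (Fin (m + 1) × Fin (n + 1)) ⊕ Fin n → R) (k) :
    prodEigenvalue (f ∘ u) k = f (prodEigenvalue u k) := by
  cases k using Fin.cases <;> simp [prodEigenvalue]

theorem eigenvalueCharData_map (f : R →+* S) (u : (Fin (m + 1) × Fin (n + 1)) ⊕ Fin n → R) (j) :
    eigenvalueCharData (f ∘ u) j = f (eigenvalueCharData u j) := by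
  cases j <;>
  simp only [eigenvalueCharData, Sum.elim_inl, Sum.elim_inr, tupleEigenvalue_map,
    prodEigenvalue_map, ← Polynomial.coeff_map, Polynomial.map_prod, Polynomial.map_sub,
    Polynomial.map_X, Polynomial.map_C]

theorem eigenvalueDiscr_map (f : R →+* S) (u : (Fin (m + 1) × Fin (n + 1)) ⊕ Fin n → R) :
    eigenvalueDiscr (f ∘ u) = f (eigenvalueDiscr u) := by
  simp only [eigenvalueDiscr, tupleEigenvalue_map, prodEigenvalue_map, map_mul, map_prod, map_sub,
    Function.comp_apply]

theorem prod_tupleEigenvalue (u : (Fin (m + 1) × Fin (n + 1)) ⊕ Fin n → R) :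
    ∏ i, ∏ k, tupleEigenvalue u i k = ∏ k, prodEigenvalue u k := by
  rw [← Fintype.prod_prod_type', Fin.prod_univ_succ]
  simp only [tupleEigenvalue, prodEigenvalue, Fin.cons_zero, Fin.cons_succ,
    Finset.prod_mul_distrib, Finset.prod_ite_eq', Finset.mem_univ, if_true]

end CharData

section

variable {K : Type*} [Field K] {n m : ℕ}

theorem exists_tupleEigenvalue_eq_and_prodEigenvalue_eq
    (l : Fin (m + 1) → Fin (n + 1) → K) (μ : Fin (n + 1) → K)
    (hμ : ∀ k, μ k ≠ 0) (hprod : ∏ i, ∏ k, l i k = ∏ k, μ k) :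
    ∃ u : (Fin (m + 1) × Fin (n + 1)) ⊕ Fin n → K,
      (∀ i k, tupleEigenvalue u i k = l i k) ∧ ∀ k, prodEigenvalue u k = μ k := by
  have hν : ∏ j : Fin n, μ j.succ ≠ 0 := Finset.prod_ne_zero_iff.2 fun j _ => hμ _
  let u : (Fin (m + 1) × Fin (n + 1)) ⊕ Fin n → K := Sum.elim
    (fun p => l p.1 p.2 * if p = (0, 0) then (∏ j : Fin n, μ j.succ)⁻¹ else 1) fun j => μ j.succ
  refine ⟨u, fun i k => ?_, fun k => ?_⟩
  · simp only [tupleEigenvalue, u, Sum.elim_inl, Sum.elim_inr]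
    split_ifs <;> simp [hν]
  · cases k using Fin.cases with
    | succ j => simp [prodEigenvalue, u]
    | zero =>
      simp only [prodEigenvalue, u, Sum.elim_inl, Fin.cons_zero, Finset.prod_mul_distrib,
        Finset.prod_ite_eq', Finset.mem_univ, if_true]
      rw [Fintype.prod_prod_type', hprod, Fin.prod_univ_succ, mul_inv_cancel_right₀ hν]

open Polynomial in
theorem exists_coeff_prod_X_sub_C_eq [IsAlgClosed K] (c : Fin (n + 1) → K) :
    ∃ f : Fin (n + 1) → K, ∀ k : Fin (n + 1),
      (∏ l, (Polynomial.X - Polynomial.C (f l))).coeff k = c k := by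
  let q : K[X] := ∑ k : Fin (n + 1), Polynomial.C (c k) * Polynomial.X ^ (k : ℕ)
  have hq : q.degree < (n + 1 : ℕ) := by
    refine (degree_sum_le _ _).trans_lt ((Finset.sup_lt_iff (WithBot.bot_lt_coe _)).2 fun k _ => ?_)
    exact (degree_C_mul_X_pow_le _ _).trans_lt (by exact_mod_cast k.2)
  let p : K[X] := Polynomial.X ^ (n + 1) + q
  have hpm : p.Monic := monic_X_pow_add hq
  have hpd : p.natDegree = n + 1 := natDegree_eq_of_degree_eq_some
    ((degree_add_eq_left_of_degree_lt (by rwa [degree_X_pow])).trans (degree_X_pow _))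
  have hcard : p.roots.toList.length = n + 1 := by
    rw [Multiset.length_toList, ← hpd]
    exact (IsAlgClosed.splits p).natDegree_eq_card_roots.symm
  refine ⟨fun l => p.roots.toList.get (l.cast hcard.symm), fun k => ?_⟩
  have hprod : ∏ l : Fin (n + 1),
      (Polynomial.X - Polynomial.C (p.roots.toList.get (l.cast hcard.symm))) = p := by
    have h1 := (IsAlgClosed.splits p).eq_prod_roots_of_monic hpm
    conv_rhs => rw [h1, ← Multiset.coe_toList p.roots, Multiset.map_coe, Multiset.prod_coe]
    rw [← Equiv.prod_comp (finCongr hcard)]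
    simp only [finCongr_apply, Fin.cast_cast, Fin.cast_eq_self]
    rw [← List.prod_ofFn]
    congr 1
    rw [← List.ofFn_get p.roots.toList, List.map_ofFn]
    simp
  rw [hprod]
  have hk : (k : ℕ) ≠ n + 1 := k.2.ne
  simp [p, q, Polynomial.coeff_X_pow, hk, Fin.val_inj]

theorem coeff_zero_prod_X_sub_C {R : Type*} [CommRing R] {n : ℕ} (f : Fin n → R) :
    (∏ l, (Polynomial.X - Polynomial.C (f l))).coeff 0 = (-1) ^ n * ∏ l, f l := by
  rw [Polynomial.coeff_zero_eq_eval_zero, Polynomial.eval_prod]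
  simp [Finset.prod_neg]

theorem exists_eigenvalueCharData_eq [IsAlgClosed K]
    (c : (Fin (m + 1) × Fin (n + 1)) ⊕ Fin n → K) (hc : ∀ i, c (.inl (i, 0)) ≠ 0) :
    ∃ u, eigenvalueCharData u = c := by
  choose l hl using fun i => exists_coeff_prod_X_sub_C_eq fun k => c (.inl (i, k))
  obtain ⟨μ, hμ⟩ := exists_coeff_prod_X_sub_C_eq
    (Fin.cons ((-1) ^ (n + 1) * ∏ i, ∏ k, l i k) fun k => c (.inr k) : Fin (n + 1) → K)
  have h1 : ((-1) ^ (n + 1) : K) ≠ 0 := pow_ne_zero _ (neg_ne_zero.2 one_ne_zero)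
  have hprod : ∏ i, ∏ k, l i k = ∏ k, μ k := by
    have := hμ 0
    rw [Fin.val_zero, coeff_zero_prod_X_sub_C, Fin.cons_zero] at this
    exact (mul_left_cancel₀ h1 this).symm
  have hl0 : ∏ i, ∏ k, l i k ≠ 0 := by
    refine Finset.prod_ne_zero_iff.2 fun i _ h => hc i ?_
    rw [← hl i 0, Fin.val_zero, coeff_zero_prod_X_sub_C, h, mul_zero]
  have hμ0 : ∀ k, μ k ≠ 0 := fun k =>
    Finset.prod_ne_zero_iff.1 (hprod ▸ hl0) k (Finset.mem_univ k)
  obtain ⟨u, hu, hu'⟩ := exists_tupleEigenvalue_eq_and_prodEigenvalue_eq l μ hμ0 hprod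
  refine ⟨u, funext fun j => ?_⟩
  cases j with
  | inl p => simp only [eigenvalueCharData, Sum.elim_inl, hu, hl]
  | inr k =>
    have := hμ k.succ
    rw [Fin.val_succ, Fin.cons_succ] at this
    simp only [eigenvalueCharData, Sum.elim_inr, hu', this]

theorem eval_tupleCharData {s : ℕ} (x : Fin s × Fin (n + 1) × Fin (n + 1) → K) (j) :
    eval x (tupleCharData X j) = tupleCharData x j := by
  rw [← tupleCharData_map]
  congr 1
  ext; simp

theorem eval_eigenvalueCharData (u : (Fin (m + 1) × Fin (n + 1)) ⊕ Fin n → K) (j) :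
    eval u (eigenvalueCharData X j) = eigenvalueCharData u j := by
  rw [← eigenvalueCharData_map]
  congr 1
  ext; simp

theorem eval_eigenvalueDiscr (u : (Fin (m + 1) × Fin (n + 1)) ⊕ Fin n → K) :
    eval u (eigenvalueDiscr X) = eigenvalueDiscr u := by
  rw [← eigenvalueDiscr_map]
  congr 1
  ext; simp

theorem eval_aeval {σ τ : Type*} (φ : τ → MvPolynomial σ K) (x : σ → K) (G : MvPolynomial τ K) :
    eval x (aeval φ G) = eval (fun j => eval x (φ j)) G := by
  have h := comp_aeval_apply φ (aeval x : MvPolynomial σ K →ₐ[K] K) G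
  simpa only [aeval_eq_eval] using h

theorem aeval_eigenvalueCharData_ne_zero [IsAlgClosed K]
    {G : MvPolynomial ((Fin (m + 1) × Fin (n + 1)) ⊕ Fin n) K} (hG : G ≠ 0) :
    aeval (eigenvalueCharData (X : (Fin (m + 1) × Fin (n + 1)) ⊕ Fin n → MvPolynomial _ K)) G
      ≠ 0 := by
  have : Infinite K := IsAlgClosed.instInfinite
  have h1 : G * ∏ i : Fin (m + 1), X (.inl (i, 0)) ≠ 0 :=
    mul_ne_zero hG (Finset.prod_ne_zero_iff.2 fun i _ => X_ne_zero _)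
  obtain ⟨c, hc⟩ : ∃ c, eval c (G * ∏ i : Fin (m + 1), X (.inl (i, 0))) ≠ 0 := by
    by_contra! h
    exact h1 (MvPolynomial.funext fun x => by rw [h x, map_zero])
  simp only [map_mul, map_prod, eval_X, mul_ne_zero_iff, Finset.prod_ne_zero_iff] at hc
  obtain ⟨u, rfl⟩ := exists_eigenvalueCharData_eq c fun i => hc.2 i (Finset.mem_univ i)
  intro h
  apply hc.1
  have h2 := eval_aeval (eigenvalueCharData X) u G
  simp only [h, map_zero, eval_eigenvalueCharData] at h2
  exact h2.symm

theorem eigenvalueDiscr_X_ne_zero [CharZero K] :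
    eigenvalueDiscr (X : (Fin (m + 1) × Fin (n + 1)) ⊕ Fin n → MvPolynomial _ K) ≠ 0 := by
  have h21 : (2 : K) ≠ 1 := by norm_num
  refine mul_ne_zero (mul_ne_zero (Finset.prod_ne_zero_iff.2 fun j _ => X_ne_zero _)
    (Finset.prod_ne_zero_iff.2 fun i _ => Finset.prod_ne_zero_iff.2 fun p hp h => h21 ?_))
    (Finset.prod_ne_zero_iff.2 fun p hp h => h21 ?_)
  · have hp : p.2 ≠ p.1 := by simpa [eq_comm] using hp
    have h' := congrArg (eval fun j => if j = Sum.inl (i, p.1) then (2 : K) else 1) h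
    rw [map_sub, ← tupleEigenvalue_map, ← tupleEigenvalue_map, map_zero, sub_eq_zero] at h'
    simp [tupleEigenvalue, hp] at h'
  · have hp : p.2 ≠ p.1 := by simpa [eq_comm] using hp
    let κ : Fin (n + 1) → (Fin (m + 1) × Fin (n + 1)) ⊕ Fin n := Fin.cons (.inl (0, 0)) .inr
    have key : ∀ k l, prodEigenvalue (fun j => if j = κ k then (2 : K) else 1) l =
        if l = k then 2 else 1 := by
      intro k l
      cases k using Fin.cases <;> cases l using Fin.cases <;>
        simp [prodEigenvalue, κ, Fin.succ_ne_zero, (Fin.succ_ne_zero _).symm]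
    have h' := congrArg (eval fun j => if j = κ p.1 then (2 : K) else 1) h
    rw [map_sub, ← prodEigenvalue_map, ← prodEigenvalue_map, map_zero, sub_eq_zero] at h'
    have hX : (eval fun j => if j = κ p.1 then (2 : K) else 1) ∘ X =
      fun j => if j = κ p.1 then (2 : K) else 1 := by ext; simp
    rw [hX, key, key] at h'
    simp [hp] at h'

end

section

variable {K : Type*} [Field K] {n m : ℕ} {u : (Fin (m + 1) × Fin (n + 1)) ⊕ Fin n → K}

theorem tupleEigenvalue_ne_zero (hu : eigenvalueDiscr u ≠ 0) (i k) :
    tupleEigenvalue u i k ≠ 0 := by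
  have h : ∀ j, u j ≠ 0 := fun j =>
    Finset.prod_ne_zero_iff.1 (left_ne_zero_of_mul (left_ne_zero_of_mul hu)) j (Finset.mem_univ j)
  rw [tupleEigenvalue]
  split_ifs
  · exact mul_ne_zero (h _) (Finset.prod_ne_zero_iff.2 fun j _ => h _)
  · simpa using h _

theorem tupleEigenvalue_injective (hu : eigenvalueDiscr u ≠ 0) (i) :
    Function.Injective (tupleEigenvalue u i) := by
  intro k l hkl
  by_contra h
  refine Finset.prod_ne_zero_iff.1 (Finset.prod_ne_zero_iff.1
    (right_ne_zero_of_mul (left_ne_zero_of_mul hu)) i (Finset.mem_univ i)) (k, l) ?_ ?_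
  · simpa using h
  · exact sub_eq_zero.2 hkl

theorem prodEigenvalue_injective (hu : eigenvalueDiscr u ≠ 0) :
    Function.Injective (prodEigenvalue u) := by
  intro k l hkl
  by_contra h
  refine Finset.prod_ne_zero_iff.1 (right_ne_zero_of_mul hu) (k, l) ?_ ?_
  · simpa using h
  · exact sub_eq_zero.2 hkl

theorem exists_pow_mul_eq_one {M : Type*} [CommMonoid M] {x y : M}
    (hx : ∃ N : ℕ, 0 < N ∧ x ^ N = 1) (hy : ∃ N : ℕ, 0 < N ∧ y ^ N = 1) :
    ∃ N : ℕ, 0 < N ∧ (x * y) ^ N = 1 := by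
  rw [← isOfFinOrder_iff_pow_eq_one] at *
  exact hx.mul hy

theorem exists_pow_prod_eq_one {M ι : Type*} [CommMonoid M] (s : Finset ι) {x : ι → M}
    (hx : ∀ i, ∃ N : ℕ, 0 < N ∧ x i ^ N = 1) : ∃ N : ℕ, 0 < N ∧ (∏ i ∈ s, x i) ^ N = 1 :=
  Finset.prod_induction _ (fun y => ∃ N : ℕ, 0 < N ∧ y ^ N = 1)
    (fun _ _ => exists_pow_mul_eq_one) ⟨1, one_pos, one_pow 1⟩ fun i _ => hx i

theorem tupleEigenvalue_pow_eq_one (hu : ∀ j, ∃ N : ℕ, 0 < N ∧ u j ^ N = 1) (i k) :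
    ∃ N : ℕ, 0 < N ∧ tupleEigenvalue u i k ^ N = 1 := by
  rw [tupleEigenvalue]
  split_ifs
  · exact exists_pow_mul_eq_one (hu _) (exists_pow_prod_eq_one _ fun _ => hu _)
  · simpa using hu _

theorem prodEigenvalue_pow_eq_one (hu : ∀ j, ∃ N : ℕ, 0 < N ∧ u j ^ N = 1) (k) :
    ∃ N : ℕ, 0 < N ∧ prodEigenvalue u k ^ N = 1 := by
  cases k using Fin.cases with
  | zero => exact exists_pow_prod_eq_one _ fun _ => hu _
  | succ j => exact hu _

end

/-- Tuples with given eigenvalues and given eigenvalues of the product exist for generic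
parameters. -/
theorem exists_tupleCharData_eq {K : Type*} [Field K] {n m : ℕ}
    (u : (Fin (m + 2) × Fin (n + 1)) ⊕ Fin n → K) (hu : eigenvalueDiscr u ≠ 0) :
    ∃ x : Fin (m + 2) × Fin (n + 1) × Fin (n + 1) → K,
      tupleCharData x = eigenvalueCharData u := by
  have hl : ∀ i k, tupleEigenvalue u i k ≠ 0 := fun i k => tupleEigenvalue_ne_zero hu i k
  obtain ⟨Y, hY, hY'⟩ := Matrix.exists_tuple_charpoly_eq hl (prodEigenvalue_injective hu)
    (prod_tupleEigenvalue u)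
  have hx : tupleMatrix (fun p : Fin (m + 2) × Fin (n + 1) × Fin (n + 1) => Y p.1 p.2.1 p.2.2) = Y :=
    rfl
  refine ⟨fun p => Y p.1 p.2.1 p.2.2, funext fun j => ?_⟩
  cases j <;> simp only [tupleCharData, eigenvalueCharData, hx, hY, hY', Sum.elim_inl, Sum.elim_inr]

theorem aeval_tupleCharData_injective {K : Type*} [Field K] [IsAlgClosed K] [CharZero K]
    (n m : ℕ) : Function.Injective (aeval (tupleCharData
      (X : Fin (m + 2) × Fin (n + 1) × Fin (n + 1) → MvPolynomial _ K)) :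
        MvPolynomial _ K →ₐ[K] MvPolynomial _ K) := by
  rw [injective_iff_map_eq_zero]
  intro G hG
  by_contra hG0
  have h1 := mul_ne_zero (aeval_eigenvalueCharData_ne_zero hG0)
    (eigenvalueDiscr_X_ne_zero (K := K) (n := n) (m := m + 1))
  refine h1 (MvPolynomial.funext fun u => ?_)
  rw [map_mul, eval_eigenvalueDiscr, eval_aeval, map_zero]
  simp only [eval_eigenvalueCharData]
  by_cases hu : eigenvalueDiscr u = 0
  · rw [hu, mul_zero]
  · obtain ⟨x, hx⟩ := exists_tupleCharData_eq u hu
    have h2 := eval_aeval (tupleCharData X) x G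
    simp only [hG, map_zero, eval_tupleCharData, hx] at h2
    rw [← h2, zero_mul]

/-- The characteristic polynomial of a matrix of size `n` is determined by its coefficients of
degree less than `n`. -/
theorem Matrix.charpoly_eq_prod_of_coeff {R : Type*} [CommRing R] [Nontrivial R] {n : ℕ}
    (M : Matrix (Fin n) (Fin n) R) (d : Fin n → R)
    (h : ∀ k < n, M.charpoly.coeff k =
      (∏ l, (Polynomial.X - Polynomial.C (d l))).coeff k) :
    M.charpoly = ∏ l, (Polynomial.X - Polynomial.C (d l)) := by
  have hm : (∏ l, (Polynomial.X - Polynomial.C (d l))).Monic :=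
    Polynomial.monic_prod_of_monic _ _ fun l _ => Polynomial.monic_X_sub_C _
  have hd : (∏ l, (Polynomial.X - Polynomial.C (d l))).natDegree = n := by
    rw [Polynomial.natDegree_prod_of_monic _ _ fun l _ => Polynomial.monic_X_sub_C _]
    simp
  have hMd : M.charpoly.natDegree = n := by
    rw [Matrix.charpoly_natDegree_eq_dim, Fintype.card_fin]
  ext k
  rcases lt_trichotomy k n with hk | rfl | hk
  · exact h k hk
  · have h1 := hm.coeff_natDegree
    have h2 := M.charpoly_monic.coeff_natDegree
    rw [hd] at h1
    rw [hMd] at h2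
    rw [h1, h2]
  · rw [Polynomial.coeff_eq_zero_of_natDegree_lt (hMd.trans_lt hk),
      Polynomial.coeff_eq_zero_of_natDegree_lt (hd.trans_lt hk)]

theorem Matrix.det_eq_prod_of_charpoly_eq_prod {R : Type*} [CommRing R] {n : ℕ}
    {M : Matrix (Fin n) (Fin n) R} {d : Fin n → R}
    (h : M.charpoly = ∏ l, (Polynomial.X - Polynomial.C (d l))) : M.det = ∏ l, d l := by
  rw [Matrix.det_eq_sign_charpoly_coeff, h, coeff_zero_prod_X_sub_C, Fintype.card_fin, ← mul_assoc,
    ← mul_pow]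
  simp

theorem charpoly_eq_of_tupleCharData_eq {K : Type*} [Field K] {n m : ℕ}
    {x : Fin (m + 1) × Fin (n + 1) × Fin (n + 1) → K}
    {u : (Fin (m + 1) × Fin (n + 1)) ⊕ Fin n → K}
    (h : ∀ j, tupleCharData x j = eigenvalueCharData u j) :
    (∀ i, (tupleMatrix x i).charpoly =
      ∏ l, (Polynomial.X - Polynomial.C (tupleEigenvalue u i l))) ∧
    (List.ofFn (tupleMatrix x)).prod.charpoly =
      ∏ l, (Polynomial.X - Polynomial.C (prodEigenvalue u l)) := by
  have h1 : ∀ i, (tupleMatrix x i).charpoly =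
      ∏ l, (Polynomial.X - Polynomial.C (tupleEigenvalue u i l)) := fun i =>
    Matrix.charpoly_eq_prod_of_coeff _ _ fun k hk => h (.inl (i, ⟨k, hk⟩))
  refine ⟨h1, Matrix.charpoly_eq_prod_of_coeff _ _ fun k hk => ?_⟩
  cases k with
  | succ k => exact h (.inr ⟨k, by omega⟩)
  | zero =>
    have hdet : (List.ofFn (tupleMatrix x)).prod.det = ∏ k, prodEigenvalue u k := by
      rw [← prod_tupleEigenvalue, ← Matrix.coe_detMonoidHom, map_list_prod, List.map_ofFn,
        List.prod_ofFn]
      exact Finset.prod_congr rfl fun i _ => Matrix.det_eq_prod_of_charpoly_eq_prod (h1 i)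
    rw [coeff_zero_prod_X_sub_C, ← hdet, Matrix.det_eq_sign_charpoly_coeff, Fintype.card_fin,
      ← mul_assoc, ← mul_pow]
    simp

theorem diagonalizableWithRootOfUnityEigenvalues_of_charpoly {r : ℕ} {g : GL (Fin r) ℂ}
    {d : Fin r → ℂ} (hd : Function.Injective d) (hd' : ∀ k, ∃ N : ℕ, 0 < N ∧ d k ^ N = 1)
    (hg : (g : Matrix (Fin r) (Fin r) ℂ).charpoly =
      ∏ k, (Polynomial.X - Polynomial.C (d k))) :
    DiagonalizableWithRootOfUnityEigenvalues g := by
  obtain ⟨P, hP⟩ := Matrix.exists_eq_conj_diagonal_of_charpoly_eq_prod _ hd hg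
  exact ⟨P, d, hd', hP⟩

theorem quasiUnipotent_tuples_zariski_dense_of_two_le (n m : ℕ)
    (F : MvPolynomial ((Fin (m + 2) × Fin (n + 1) × Fin (n + 1)) ⊕ Fin (m + 2)) ℂ)
    (hvanish : ∀ g : Fin (m + 2) → GL (Fin (n + 1)) ℂ,
      (∀ i, DiagonalizableWithRootOfUnityEigenvalues (g i)) →
      DiagonalizableWithRootOfUnityEigenvalues (List.ofFn g).prod →
      eval (glPoint g) F = 0) (g : Fin (m + 2) → GL (Fin (n + 1)) ℂ) :
    eval (glPoint g) F = 0 := by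
  by_contra hg
  let D : Fin (m + 2) → MvPolynomial (Fin (m + 2) × Fin (n + 1) × Fin (n + 1)) ℂ :=
    fun i => (tupleMatrix X i).det
  have hD : ∀ x i, eval x (D i) = (tupleMatrix x i).det := by
    intro x i
    rw [RingHom.map_det, ← tupleMatrix_map]
    congr 2
    ext; simp
  have hpt : ∀ (x : Fin (m + 2) × Fin (n + 1) × Fin (n + 1) → ℂ)
      (g : Fin (m + 2) → GL (Fin (n + 1)) ℂ),
      (∀ i, tupleMatrix x i = (g i : Matrix (Fin (n + 1)) (Fin (n + 1)) ℂ)) →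
      Sum.elim x (fun i => (eval x (D i))⁻¹) = glPoint g := by
    intro x g h
    ext j
    cases j with
    | inl p => simp [glPoint, ← h, tupleMatrix]
    | inr i => simp [glPoint, hD, ← h]
  obtain ⟨N, G, hG⟩ := exists_eval_sumElim_inv_mul_prod_pow D F
  have hb : G * ∏ i, D i ≠ 0 := by
    let x : Fin (m + 2) × Fin (n + 1) × Fin (n + 1) → ℂ := fun p => (g p.1).1 p.2.1 p.2.2
    have hx : ∀ i, tupleMatrix x i = (g i : Matrix (Fin (n + 1)) (Fin (n + 1)) ℂ) := fun i => rfl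
    have hdet : ∀ i, eval x (D i) ≠ 0 := fun i => by
      rw [hD, hx]
      exact ((Matrix.isUnit_iff_isUnit_det _).1 (g i).isUnit).ne_zero
    intro h
    have h1 := congrArg (eval x) h
    rw [map_mul, map_prod, hG x hdet, hpt x g hx, map_zero] at h1
    have h2 := Finset.prod_ne_zero_iff.2 fun i (_ : i ∈ Finset.univ) => hdet i
    exact mul_ne_zero (mul_ne_zero hg (pow_ne_zero N h2)) h2 h1
  obtain ⟨a, ha, hfib⟩ := exists_forall_eval_ne_zero_of_injective _
    (aeval_tupleCharData_injective (K := ℂ) n m) hb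
  obtain ⟨u, hu, hu'⟩ := exists_rootsOfUnity_eval_ne_zero
    (mul_ne_zero (aeval_eigenvalueCharData_ne_zero ha)
      (eigenvalueDiscr_X_ne_zero (K := ℂ) (n := n) (m := m + 1)))
  rw [map_mul, eval_eigenvalueDiscr, eval_aeval, mul_ne_zero_iff] at hu'
  obtain ⟨x, hx, hxb⟩ := hfib _ hu'.1
  simp only [eval_tupleCharData, eval_eigenvalueCharData] at hx
  obtain ⟨hx1, hx2⟩ := charpoly_eq_of_tupleCharData_eq hx
  rw [map_mul, map_prod, mul_ne_zero_iff, Finset.prod_ne_zero_iff] at hxb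
  have hdet : ∀ i, eval x (D i) ≠ 0 := fun i => hxb.2 i (Finset.mem_univ i)
  let g' : Fin (m + 2) → GL (Fin (n + 1)) ℂ := fun i =>
    Matrix.GeneralLinearGroup.mkOfDetNeZero (tupleMatrix x i) (hD x i ▸ hdet i)
  have hg' : ∀ i, tupleMatrix x i = (g' i : Matrix (Fin (n + 1)) (Fin (n + 1)) ℂ) := fun i => rfl
  apply hxb.1
  rw [hG x hdet, hpt x g' hg', hvanish g', zero_mul]
  · exact fun i => diagonalizableWithRootOfUnityEigenvalues_of_charpoly
      (tupleEigenvalue_injective hu'.2 i) (tupleEigenvalue_pow_eq_one hu i) (hx1 i)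
  · refine diagonalizableWithRootOfUnityEigenvalues_of_charpoly
      (prodEigenvalue_injective hu'.2) (prodEigenvalue_pow_eq_one hu) ?_
    rw [← hx2]
    congr 1
    have h := map_list_prod (Units.coeHom (Matrix (Fin (n + 1)) (Fin (n + 1)) ℂ)) (List.ofFn g')
    rw [List.map_ofFn] at h
    exact h

theorem diagonalizableWithRootOfUnityEigenvalues_one (r : ℕ) :
    DiagonalizableWithRootOfUnityEigenvalues (1 : GL (Fin r) ℂ) :=
  ⟨1, fun _ => 1, fun _ => ⟨1, one_pos, one_pow 1⟩, by simp⟩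

/-- The set of tuples `(g₁,…,g_s) ∈ GL_r(ℂ)^s` such that each `gᵢ` and the product
`g₁⋯g_s` (ordered product) are diagonalizable with root-of-unity eigenvalues is Zariski dense in
`GL_r(ℂ)^s`: every polynomial (in the matrix entries and inverse determinants)
vanishing on this set vanishes on all of `GL_r(ℂ)^s`. -/
theorem quasiUnipotent_tuples_zariski_dense (r s : ℕ)
    (F : MvPolynomial ((Fin s × Fin r × Fin r) ⊕ Fin s) ℂ)
    (hvanish : ∀ g : Fin s → GL (Fin r) ℂ,
      (∀ i, DiagonalizableWithRootOfUnityEigenvalues (g i)) →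
      DiagonalizableWithRootOfUnityEigenvalues (List.ofFn g).prod →
      eval (glPoint g) F = 0) :
    ∀ g : Fin s → GL (Fin r) ℂ, eval (glPoint g) F = 0 := by
  intro g
  match r, s with
  | 0, s =>
    have h1 : ∀ h : GL (Fin 0) ℂ, DiagonalizableWithRootOfUnityEigenvalues h := fun h =>
      Subsingleton.elim (1 : GL (Fin 0) ℂ) h ▸ diagonalizableWithRootOfUnityEigenvalues_one 0
    exact hvanish g (fun i => h1 _) (h1 _)
  | n + 1, 0 =>
    refine hvanish g (fun i => i.elim0) ?_
    rw [List.ofFn_zero, List.prod_nil]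
    exact diagonalizableWithRootOfUnityEigenvalues_one _
  | n + 1, 1 =>
    let e : (Fin 1 × Fin (n + 1) × Fin (n + 1)) ⊕ Fin 1 →
        (Fin 2 × Fin (n + 1) × Fin (n + 1)) ⊕ Fin 2 :=
      Sum.map (Prod.map Fin.castSucc id) Fin.castSucc
    have he : ∀ h : Fin 2 → GL (Fin (n + 1)) ℂ,
        eval (glPoint h) (rename e F) = eval (glPoint fun i : Fin 1 => h i.castSucc) F := by
      intro h
      rw [eval_rename]
      congr 2
      ext j
      cases j <;> rfl
    have h2 := quasiUnipotent_tuples_zariski_dense_of_two_le n 0 (rename e F) (fun h hh _ => by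
      rw [he]
      refine hvanish _ (fun i => hh _) ?_
      simpa using hh 0) fun _ => g 0
    rw [he] at h2
    have hg : g = fun _ => g 0 := funext fun i => by rw [Subsingleton.elim i 0]
    rw [hg]
    exact h2
  | n + 1, m + 2 => exact quasiUnipotent_tuples_zariski_dense_of_two_le n m F hvanish g
end

section
/- Let A be a complete local Noetherian ring and B = A⟦X₁,…,X_j⟧/(f₁,…,f_j) a quotient of the formal power series ring by j elements such that B ⊗_A k is a finite-dimensional k-vector space, where k is the residue field of A. Then B is finite and flat over A. -/
section Koszul

variable {R V : Type*} [CommRing R] [AddCommGroup V] [Module R V]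

open AlternatingMap

/-- Left multiplication by a linear functional `c` on alternating forms is a homotopy between
multiplication by `c v` and zero for the contraction with the vector `v`. -/
theorem AlternatingMap.curryLeft_alternatizeUncurryFin_smulRight (c : V →ₗ[R] R) (v : V) {i : ℕ}
    (z : V [⋀^Fin (i + 1)]→ₗ[R] R) :
    (alternatizeUncurryFin (c.smulRight z)).curryLeft v =
      c v • z - alternatizeUncurryFin (c.smulRight (z.curryLeft v)) := by
  ext w
  simp only [curryLeft_apply_apply, alternatizeUncurryFin_apply, Fin.sum_univ_succ (n := i + 1),
    sub_apply, smul_apply, LinearMap.smulRight_apply, Matrix.vecCons]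
  rw [sub_eq_add_neg, ← Finset.sum_neg_distrib]
  congr 1
  · simp
  · refine Finset.sum_congr rfl fun k _ ↦ ?_
    have : Fin.removeNth k.succ (Fin.cons v w : Fin (i + 2) → V) = Fin.cons v (k.removeNth w) := by
      ext l
      refine Fin.cases ?_ (fun l ↦ ?_) l <;> simp [Fin.removeNth]
    rw [this]
    simp [pow_succ]

/-- An alternating form with values in a sum of ideals `J ⊔ (x)` is the sum of a form with values
in `J` and a multiple of `x`. -/
theorem AlternatingMap.exists_eq_add_smul_of_mem_sup_span [Module.Free R V] {i : ℕ} (J : Ideal R)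
    (x : R) (a : V [⋀^Fin i]→ₗ[R] R) (ha : ∀ v, a v ∈ J ⊔ Ideal.span {x}) :
    ∃ u w : V [⋀^Fin i]→ₗ[R] R, (∀ v, u v ∈ J) ∧ a = u + x • w := by
  let p : J × R →ₗ[R] ↥(J ⊔ Ideal.span {x}) :=
    (J.subtype.coprod (x • LinearMap.id)).codRestrict _ fun y ↦ by
      refine Submodule.add_mem_sup y.1.2 (Ideal.mem_span_singleton.mpr ?_)
      exact Dvd.intro _ rfl
  have hp_apply (y : J × R) : (p y : R) = y.1 + x * y.2 := rfl
  have hp : Function.Surjective p := by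
    rintro ⟨y, hy⟩
    obtain ⟨s, hs, t, ht, rfl⟩ := Submodule.mem_sup.mp hy
    obtain ⟨t, rfl⟩ := Ideal.mem_span_singleton.mp ht
    exact ⟨(⟨s, hs⟩, t), Subtype.ext (hp_apply _)⟩
  obtain ⟨h, hh⟩ := Module.projective_lifting_property p
    (exteriorPower.alternatingMapLinearEquiv (a.codRestrict _ ha)) hp
  let b := h.compAlternatingMap (exteriorPower.ιMulti R i)
  refine ⟨(J.subtype ∘ₗ LinearMap.fst R J R).compAlternatingMap b,
    (LinearMap.snd R J R).compAlternatingMap b, fun v ↦ by simp, ?_⟩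
  ext v
  simpa [hp_apply, b] using congr(($hh (exteriorPower.ιMulti R i v) : R)).symm

/-- Exactness, modulo the ideal `J`, of the Koszul complex of the vector `f`, realised as the
complex of alternating forms with the contraction with `f` as differential, in degree `i + 1`. -/
def KoszulExactMod (f : V) (J : Ideal R) (i : ℕ) : Prop :=
  ∀ z : V [⋀^Fin (i + 1)]→ₗ[R] R, (∀ v, z.curryLeft f v ∈ J) →
    ∃ w : V [⋀^Fin (i + 2)]→ₗ[R] R, ∀ v, z v - w.curryLeft f v ∈ J

theorem KoszulExactMod.of_sup_span [Module.Free R V] {f : V} {J : Ideal R} {i : ℕ} (c : V →ₗ[R] R)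
    (hc : ∀ a, c f * a ∈ J → a ∈ J) (h : KoszulExactMod f (J ⊔ Ideal.span {c f}) (i + 1)) :
    KoszulExactMod f J i := by
  intro z hz
  have hεz (v) : alternatizeUncurryFin (c.smulRight (z.curryLeft f)) v ∈ J := by
    rw [alternatizeUncurryFin_apply]
    refine sum_mem fun k _ ↦ ?_
    rw [LinearMap.smulRight_apply, AlternatingMap.smul_apply, zsmul_eq_mul]
    exact J.mul_mem_left _ (J.mul_mem_left _ (hz _))
  obtain ⟨w, hw⟩ := h (alternatizeUncurryFin (c.smulRight z)) fun v ↦ by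
    rw [curryLeft_alternatizeUncurryFin_smulRight, AlternatingMap.sub_apply,
      AlternatingMap.smul_apply]
    refine sub_mem (Ideal.mem_sup_right ?_) (Ideal.mem_sup_left (hεz v))
    exact Ideal.mul_mem_right _ _ (Ideal.mem_span_singleton_self _)
  obtain ⟨u, w', hu, hw'⟩ := exists_eq_add_smul_of_mem_sup_span J (c f)
    (alternatizeUncurryFin (c.smulRight z) - w.curryLeft f) hw
  refine ⟨w', fun v ↦ hc _ ?_⟩
  have key := congr(($hw').curryLeft f v)
  have hcurry : (alternatizeUncurryFin (c.smulRight z)).curryLeft f v =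
      c f * z v - alternatizeUncurryFin (c.smulRight (z.curryLeft f)) v := by
    rw [curryLeft_alternatizeUncurryFin_smulRight]; rfl
  have hww : (w.curryLeft f).curryLeft f v = 0 := by simp
  simp only [curryLeft_apply_apply, AlternatingMap.sub_apply, AlternatingMap.add_apply,
    AlternatingMap.smul_apply, smul_eq_mul] at key hcurry hww ⊢
  have : c f * (z v - w' (Matrix.vecCons f v)) =
      alternatizeUncurryFin (c.smulRight (z.curryLeft f)) v + u (Matrix.vecCons f v) := by
    linear_combination key - hcurry + hww
  rw [this]
  exact add_mem (hεz v) (hu _)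

theorem koszulExactMod_of_card_le {ι : Type*} [Fintype ι] (f : ι → R) (J : Ideal R) {i : ℕ}
    (hi : Fintype.card ι ≤ i) : KoszulExactMod f J i := by
  intro z _
  have : z = 0 := Module.Basis.ext_alternating (Pi.basisFun R ι) fun v hv ↦ by
    have := Fintype.card_le_of_injective v hv
    simp at this
    omega
  exact ⟨0, fun v ↦ by simp [this]⟩

/-- If the ideal generated by the `j` entries of `f` contains a sequence of `j` elements that is
regular modulo `J 0`, every relation between the entries of `f` modulo `J 0` is congruent to a
Koszul relation; in particular it may be replaced by one with coefficients in `J 0`. -/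
theorem exists_apply_eq_of_regular {j : ℕ} (f : Fin j → R) (J : ℕ → Ideal R)
    (c : ℕ → (Fin j → R) →ₗ[R] R) (hJ : ∀ t < j, J (t + 1) = J t ⊔ Ideal.span {c t f})
    (hc : ∀ t < j, ∀ a, c t f * a ∈ J t → a ∈ J t) (g : (Fin j → R) →ₗ[R] R) (hg : g f ∈ J 0) :
    ∃ g' : (Fin j → R) →ₗ[R] R, g' f = g f ∧ ∀ v, g' v ∈ J 0 := by
  have hexact (t : ℕ) (ht : t ≤ j) : KoszulExactMod f (J t) t := by
    induction ht using Nat.decreasingInduction with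
    | of_succ t ht ih => exact .of_sup_span (c t) (hc t ht) (hJ t ht ▸ ih)
    | self => exact koszulExactMod_of_card_le _ _ (by simp)
  obtain ⟨w, hw⟩ := hexact 0 (Nat.zero_le _)
    (g.compAlternatingMap (ofSubsingleton R _ _ (0 : Fin 1) .id)) (by simpa using hg)
  let w' : (Fin j → R) →ₗ[R] R := (ofSubsingleton R _ _ (0 : Fin 1)).symm (w.curryLeft f)
  refine ⟨g - w', ?_, fun v ↦ ?_⟩
  · have : w.curryLeft f (fun _ ↦ f) = 0 :=
      w.map_eq_zero_of_eq (i := 0) (j := 1) _ (by simp) (by simp)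
    simpa [w'] using this
  · simpa [w'] using hw fun _ ↦ v

end Koszul

section Flat

open TensorProduct

/-- If `R` is a flat `A`-algebra and `I ∩ 𝔞R ⊆ I * 𝔞R`, then `𝔞 ⊗ R ⧸ I → R ⧸ I` is injective. -/
theorem Ideal.rTensor_subtype_quotient_injective {A R : Type*} [CommRing A] [CommRing R]
    [Algebra A R] [Module.Flat A R] (a : Ideal A) (I : Ideal R)
    (h : I ⊓ a.map (algebraMap A R) ≤ I * a.map (algebraMap A R)) :
    Function.Injective (a.subtype.rTensor (R ⧸ I)) := by
  let ψ : a ⊗[A] R →ₗ[A] R := (TensorProduct.lid A R).toLinearMap ∘ₗ a.subtype.rTensor R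
  have hψ : Function.Injective ψ := (TensorProduct.lid A R).injective.comp
    (Module.Flat.rTensor_preserves_injective_linearMap _ Subtype.val_injective)
  let π : R →ₗ[A] R ⧸ I := (Ideal.Quotient.mkₐ A I).toLinearMap
  have hπ : Function.Surjective π := Ideal.Quotient.mk_surjective
  have hψ_mul (r : R) (z : a ⊗[A] R) : ψ ((LinearMap.mulLeft A r).lTensor a z) = r * ψ z := by
    induction z with
    | zero => simp
    | tmul x y => simp [ψ]
    | add x y hx hy => simp [mul_add, hx, hy]
  have hψ_range (z : a ⊗[A] R) : ψ z ∈ a.map (algebraMap A R) := by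
    induction z with
    | zero => simp
    | tmul x y =>
      simpa [ψ, Algebra.smul_def] using Ideal.mul_mem_right _ _ (Ideal.mem_map_of_mem _ x.2)
    | add x y hx hy => simpa using add_mem hx hy
  have hψ_surj (y : R) (hy : y ∈ a.map (algebraMap A R)) : ∃ z, ψ z = y := by
    refine Submodule.span_induction ?_ ⟨0, by simp⟩ ?_ ?_ hy
    · rintro _ ⟨x, hx, rfl⟩
      exact ⟨⟨x, hx⟩ ⊗ₜ 1, by simp [ψ, Algebra.smul_def]⟩
    · rintro _ _ _ _ ⟨z, rfl⟩ ⟨w, rfl⟩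
      exact ⟨z + w, map_add _ _ _⟩
    · rintro r _ _ ⟨z, rfl⟩
      exact ⟨_, hψ_mul r z⟩
  have hlift (y : R) (hy : y ∈ I * a.map (algebraMap A R)) :
      ∃ z, ψ z = y ∧ π.lTensor a z = 0 := by
    refine Submodule.mul_induction_on hy (fun r hr s hs ↦ ?_) ?_
    · obtain ⟨z, rfl⟩ := hψ_surj s hs
      refine ⟨_, hψ_mul r z, ?_⟩
      rw [← LinearMap.comp_apply, ← LinearMap.lTensor_comp]
      have : π ∘ₗ LinearMap.mulLeft A r = 0 := by
        ext s
        exact Ideal.Quotient.eq_zero_iff_mem.mpr (I.mul_mem_right s hr)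
      simp [this]
    · rintro _ _ ⟨z, rfl, hz⟩ ⟨w, rfl, hw⟩
      exact ⟨z + w, map_add _ _ _, by simp [hz, hw]⟩
  rw [injective_iff_map_eq_zero]
  intro x hx
  obtain ⟨z, rfl⟩ := LinearMap.lTensor_surjective a hπ x
  have hcomm (z : a ⊗[A] R) : π (ψ z) =
      TensorProduct.lid A _ (a.subtype.rTensor _ (π.lTensor a z)) := by
    induction z with
    | zero => simp
    | tmul x y => simp [ψ]
    | add x y hx hy => simp only [map_add, hx, hy]
  specialize hcomm z
  rw [hx, map_zero] at hcomm
  obtain ⟨w, hw, hw0⟩ := hlift _ (h ⟨Ideal.Quotient.eq_zero_iff_mem.mp hcomm, hψ_range z⟩)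
  rwa [← hψ hw]

end Flat

section Complete

theorem Ideal.mem_smul_top_pi_iff {A ι : Type*} [CommRing A] [Finite ι] {I : Ideal A} {v : ι → A} :
    v ∈ (I • ⊤ : Submodule A (ι → A)) ↔ ∀ i, v i ∈ I := by
  classical
  have := Fintype.ofFinite ι
  constructor
  · intro hv i
    refine Submodule.smul_induction_on hv (fun r hr w _ ↦ ?_) fun _ _ hx hy ↦ add_mem hx hy
    exact I.mul_mem_right _ hr
  · intro hv
    rw [pi_eq_sum_univ v]
    exact _root_.sum_mem fun i _ ↦ Submodule.smul_mem_smul (hv i) Submodule.mem_top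

instance IsPrecomplete.pi {A ι : Type*} [CommRing A] [Finite ι] (I : Ideal A) [IsPrecomplete I A] :
    IsPrecomplete I (ι → A) where
  prec' f hf := by
    have hf' (i : ι) : ∃ L : A, ∀ n, f n i ≡ L [SMOD (I ^ n • ⊤ : Submodule A A)] := by
      refine IsPrecomplete.prec ‹_› fun {m n} hmn ↦ ?_
      have := hf hmn
      rw [SModEq.sub_mem, Ideal.mem_smul_top_pi_iff] at this
      simpa [SModEq.sub_mem] using this i
    choose L hL using hf'
    refine ⟨L, fun n ↦ ?_⟩
    rw [SModEq.sub_mem, Ideal.mem_smul_top_pi_iff]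
    intro i
    simpa [SModEq.sub_mem] using hL i n

/-- A module that is separated for the adic topology of an ideal `I` of an `I`-adically complete
ring is finite as soon as it is finite modulo `I`. -/
theorem Module.Finite.of_isPrecomplete {A M : Type*} [CommRing A] [AddCommGroup M] [Module A M]
    (I : Ideal A) [IsPrecomplete I A] [IsHausdorff I M]
    [Module.Finite A (M ⧸ (I • ⊤ : Submodule A M))] : Module.Finite A M := by
  obtain ⟨d, g, hg⟩ := Module.Finite.exists_fin' A (M ⧸ (I • ⊤ : Submodule A M))
  obtain ⟨h, hh⟩ := Module.projective_lifting_property (Submodule.mkQ (I • ⊤ : Submodule A M)) g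
    (Submodule.mkQ_surjective _)
  exact .of_surjective h (surjective_of_mkQ_comp_surjective (I := I) (by rwa [hh]))

end Complete

namespace MvPowerSeries

variable {σ A : Type*} [CommRing A]

open Finsupp

instance flat [IsNoetherianRing A] : Module.Flat A (MvPowerSeries σ A) := by
  refine .of_forall_isTrivialRelation fun {l f x} h ↦ ?_
  let K := LinearMap.ker (Fintype.linearCombination A f)
  obtain ⟨n, s, hs⟩ := Module.Finite.exists_fin (R := A) (M := K)
  have hK (e : σ →₀ ℕ) : (fun i ↦ coeff e (x i)) ∈ K := by
    simpa [K, Fintype.linearCombination_apply, mul_comm] using congr(coeff e $h)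
  have hc (e : σ →₀ ℕ) : ∃ c : Fin n → A, ∑ q, c q • s q = ⟨_, hK e⟩ :=
    (Submodule.mem_span_range_iff_exists_fun A).mp (hs ▸ Submodule.mem_top)
  choose c hc using hc
  refine ⟨n, fun i q ↦ (s q : Fin l → A) i, fun q e ↦ c e q, fun i ↦ ?_, fun q ↦ ?_⟩
  · ext e
    have := congr((($(hc e)) : Fin l → A) i)
    simp only [Submodule.coe_sum, Submodule.coe_smul, Finset.sum_apply, Pi.smul_apply,
      smul_eq_mul] at this
    rw [← this, map_sum]
    exact Finset.sum_congr rfl fun q _ ↦ mul_comm _ _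
  · have := LinearMap.mem_ker.mp (s q).2
    simpa only [Fintype.linearCombination_apply, smul_eq_mul, mul_comm] using this

/-- The ideal of power series whose coefficients at all exponents `e` with `e s < N s` for `s ∈ S`
lie in `I`; it is generated by `I` and the powers `X s ^ N s` with `s ∈ S` if `S` is finite and
`I` is finitely generated. -/
def boxIdeal (I : Ideal A) (N : σ → ℕ) (S : Set σ) : Ideal (MvPowerSeries σ A) where
  carrier := {a | ∀ e : σ →₀ ℕ, (∀ s ∈ S, e s < N s) → coeff e a ∈ I}
  add_mem' ha hb e he := by simpa using add_mem (ha e he) (hb e he)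
  zero_mem' := by simp
  smul_mem' r a ha e he := by
    classical
    rw [smul_eq_mul, coeff_mul]
    refine sum_mem fun p hp ↦ I.mul_mem_left _ (ha _ fun s hs ↦ (he s hs).trans_le' ?_)
    rw [← Finset.HasAntidiagonal.mem_antidiagonal.mp hp]
    simp

theorem mem_boxIdeal {I : Ideal A} {N : σ → ℕ} {S : Set σ} {a : MvPowerSeries σ A} :
    a ∈ boxIdeal I N S ↔ ∀ e : σ →₀ ℕ, (∀ s ∈ S, e s < N s) → coeff e a ∈ I := Iff.rfl

theorem boxIdeal_mono (I : Ideal A) (N : σ → ℕ) {S T : Set σ} (h : S ⊆ T) :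
    boxIdeal I N S ≤ boxIdeal I N T :=
  fun _ ha e he ↦ ha e fun s hs ↦ he s (h hs)

theorem boxIdeal_empty (I : Ideal A) (N : σ → ℕ) (hI : I.FG) :
    boxIdeal I N ∅ = I.map (algebraMap A (MvPowerSeries σ A)) := by
  refine le_antisymm (fun a ha ↦ ?_) (Ideal.map_le_iff_le_comap.mpr fun r hr e _ ↦ ?_)
  · obtain ⟨n, u, rfl⟩ := Submodule.fg_iff_exists_fin_generating_family.mp hI
    have hc (e : σ →₀ ℕ) : ∃ c : Fin n → A, ∑ q, c q • u q = coeff e a :=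
      (Submodule.mem_span_range_iff_exists_fun A).mp (ha e (by simp))
    choose c hc using hc
    let b (q : Fin n) : MvPowerSeries σ A := fun e ↦ c e q
    have : a = ∑ q, algebraMap A (MvPowerSeries σ A) (u q) * b q := by
      ext e
      rw [← hc, map_sum]
      refine Finset.sum_congr rfl fun q _ ↦ ?_
      rw [← Algebra.smul_def, coeff_smul, smul_eq_mul, mul_comm]
      rfl
    rw [this]
    refine sum_mem fun q _ ↦ Ideal.mul_mem_right _ _ (Ideal.mem_map_of_mem _ ?_)
    exact Submodule.subset_span ⟨q, rfl⟩
  · rw [Algebra.algebraMap_eq_smul_one, coeff_smul]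
    exact I.mul_mem_right _ hr

theorem coeff_X_pow_mul_add (s : σ) (n : ℕ) (e : σ →₀ ℕ) (a : MvPowerSeries σ A) :
    coeff (single s n + e) (X s ^ n * a) = coeff e a := by
  rw [X_pow_eq, coeff_add_monomial_mul, one_mul]

/-- The power `X s ^ N s` is a nonzerodivisor modulo `boxIdeal I N S` if `s ∉ S`. -/
theorem mem_boxIdeal_of_X_pow_mul_mem {I : Ideal A} {N : σ → ℕ} {S : Set σ} {s : σ} (hs : s ∉ S)
    {a : MvPowerSeries σ A} (ha : X s ^ N s * a ∈ boxIdeal I N S) : a ∈ boxIdeal I N S := by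
  classical
  intro e he
  rw [← coeff_X_pow_mul_add s (N s)]
  refine ha _ fun t ht ↦ ?_
  have : s ≠ t := fun h ↦ hs (h ▸ ht)
  simpa [single_apply, this] using he t ht

theorem boxIdeal_insert (I : Ideal A) (N : σ → ℕ) (S : Set σ) (s : σ) :
    boxIdeal I N (insert s S) = boxIdeal I N S ⊔ Ideal.span {X s ^ N s} := by
  classical
  refine le_antisymm (fun a ha ↦ ?_) (sup_le (boxIdeal_mono _ _ (Set.subset_insert _ _)) ?_)
  · let b : MvPowerSeries σ A := fun e ↦ coeff (single s (N s) + e) a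
    rw [← sub_add_cancel a (X s ^ N s * b)]
    refine Submodule.add_mem_sup (fun e he ↦ ?_) (Ideal.mem_span_singleton.mpr (dvd_mul_right _ _))
    by_cases hes : e s < N s
    · rw [map_sub, X_pow_eq, coeff_monomial_mul, if_neg (by simpa using hes), sub_zero]
      exact ha e (by simpa [hes] using he)
    · have : single s (N s) ≤ e := by simpa using hes
      obtain ⟨e, rfl⟩ := exists_add_of_le this
      rw [map_sub, coeff_X_pow_mul_add]
      rw [show coeff e b = coeff (single s (N s) + e) a from rfl, sub_self]
      exact I.zero_mem
  · rw [Ideal.span_singleton_le_iff_mem]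
    intro e he
    rw [coeff_X_pow, if_neg]
    · exact I.zero_mem
    · rintro rfl
      simpa using he s (Set.mem_insert _ _)

end MvPowerSeries

section FiniteFibre

open IsLocalRing TensorProduct

variable {A : Type*} [CommRing A] [IsLocalRing A]

/-- The fibre `B ⧸ 𝔪B` over the closed point is `k ⊗ B`. -/
noncomputable def IsLocalRing.quotientMapEquivResidueFieldTensor (B : Type*) [CommRing B]
    [Algebra A B] :
    (B ⧸ (maximalIdeal A).map (algebraMap A B)) ≃ₐ[A] ResidueField A ⊗[A] B :=
  ((Algebra.TensorProduct.quotIdealMapEquivTensorQuot B (maximalIdeal A)).restrictScalars A).trans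
    (Algebra.TensorProduct.comm A B (A ⧸ maximalIdeal A))

theorem MvPowerSeries.mk_mem_jacobson_bot {σ B : Type*} [CommRing B]
    {g : MvPowerSeries σ A →+* B} (hg : Function.Surjective g) {x : MvPowerSeries σ A}
    (hx : constantCoeff x ∈ maximalIdeal A) : g x ∈ Ideal.jacobson (⊥ : Ideal B) := by
  rw [Ideal.mem_jacobson_bot]
  intro y
  obtain ⟨r, rfl⟩ := hg y
  rw [← map_mul, ← map_one g, ← map_add]
  refine .map g (isUnit_iff_constantCoeff.mpr ?_)
  rw [map_add, map_mul, map_one]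
  by_contra h
  refine (Ideal.ne_top_iff_one _).mp (maximalIdeal.isMaximal A).ne_top ?_
  have := sub_mem ((mem_maximalIdeal _).mpr h)
    (Ideal.mul_mem_right (constantCoeff r) (maximalIdeal A) hx)
  simp at this

variable {σ : Type*} (I : Ideal (MvPowerSeries σ A))
  [hfin : Module.Finite (ResidueField A) (ResidueField A ⊗[A] (MvPowerSeries σ A ⧸ I))]

theorem MvPowerSeries.exists_X_pow_mem (s : σ) :
    ∃ N, X s ^ N ∈ I ⊔ (maximalIdeal A).map (algebraMap A (MvPowerSeries σ A)) := by
  let e := quotientMapEquivResidueFieldTensor (A := A) (MvPowerSeries σ A ⧸ I)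
  have : IsArtinianRing (ResidueField A ⊗[A] (MvPowerSeries σ A ⧸ I)) :=
    isArtinian_of_tower (ResidueField A) inferInstance
  let g : MvPowerSeries σ A →+* ResidueField A ⊗[A] (MvPowerSeries σ A ⧸ I) :=
    (e.toRingEquiv.toRingHom).comp ((Ideal.Quotient.mk _).comp (Ideal.Quotient.mk I))
  have hg : Function.Surjective g := e.surjective.comp
    (Ideal.Quotient.mk_surjective.comp Ideal.Quotient.mk_surjective)
  obtain ⟨N, hN⟩ := IsArtinianRing.isNilpotent_jacobson_bot
    (R := ResidueField A ⊗[A] (MvPowerSeries σ A ⧸ I))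
  have h0 : g (X s ^ N) = 0 := by
    have hX : g (X s) ∈ Ideal.jacobson (⊥ : Ideal (ResidueField A ⊗[A] (MvPowerSeries σ A ⧸ I))) :=
      mk_mem_jacobson_bot (B := ResidueField A ⊗[A] (MvPowerSeries σ A ⧸ I)) hg (by simp)
    replace hX := Ideal.pow_mem_pow hX N
    rw [hN] at hX
    exact (map_pow g _ N).trans (Ideal.mem_bot.mp hX)
  refine ⟨N, ?_⟩
  have h1 : Ideal.Quotient.mk I (X s ^ N) ∈
      (maximalIdeal A).map (algebraMap A (MvPowerSeries σ A ⧸ I)) := by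
    rw [← Ideal.Quotient.eq_zero_iff_mem]
    exact e.injective (h0.trans (map_zero e).symm)
  rw [IsScalarTower.algebraMap_eq A (MvPowerSeries σ A), ← Ideal.map_map,
    Ideal.Quotient.algebraMap_eq, ← Ideal.mem_comap,
    Ideal.comap_map_of_surjective _ Ideal.Quotient.mk_surjective, ← RingHom.ker_eq_comap_bot,
    Ideal.mk_ker] at h1
  rwa [sup_comm]

theorem MvPowerSeries.finite_quotient [IsNoetherianRing A] [Finite σ]
    [IsPrecomplete (maximalIdeal A) A] :
    Module.Finite A (MvPowerSeries σ A ⧸ I) := by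
  have hjac : (maximalIdeal A).map (algebraMap A (MvPowerSeries σ A ⧸ I)) ≤ Ideal.jacobson ⊥ := by
    refine Ideal.map_le_iff_le_comap.mpr fun a ha ↦ ?_
    refine mk_mem_jacobson_bot (g := Ideal.Quotient.mk I) (x := algebraMap A _ a)
      Ideal.Quotient.mk_surjective ?_
    simpa [MvPowerSeries.algebraMap_apply] using ha
  have : IsHausdorff (maximalIdeal A) (MvPowerSeries σ A ⧸ I) :=
    IsHausdorff.map_algebraMap_iff.mp (IsHausdorff.of_le_jacobson _ (MvPowerSeries σ A ⧸ I) hjac)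
  have : Module.Finite A (ResidueField A ⊗[A] (MvPowerSeries σ A ⧸ I)) :=
    .trans (ResidueField A) _
  have : Module.Finite A ((MvPowerSeries σ A ⧸ I) ⧸
      (maximalIdeal A • ⊤ : Submodule A (MvPowerSeries σ A ⧸ I))) := by
    rw [Ideal.smul_top_eq_map]
    exact .equiv (quotientMapEquivResidueFieldTensor (A := A) _).symm.toLinearEquiv
  exact .of_isPrecomplete (maximalIdeal A)

end FiniteFibre

section Fin

open IsLocalRing TensorProduct MvPowerSeries

variable {A : Type*} [CommRing A] [IsLocalRing A] [IsNoetherianRing A] {j : ℕ}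
  (f : Fin j → MvPowerSeries (Fin j) A)
  [hfin : Module.Finite (ResidueField A)
    (ResidueField A ⊗[A] (MvPowerSeries (Fin j) A ⧸ Ideal.span (Set.range f)))]

theorem MvPowerSeries.span_inf_map_maximalIdeal_le :
    Ideal.span (Set.range f) ⊓ (maximalIdeal A).map (algebraMap A (MvPowerSeries (Fin j) A)) ≤
      Ideal.span (Set.range f) *
        (maximalIdeal A).map (algebraMap A (MvPowerSeries (Fin j) A)) := by
  choose N hN using exists_X_pow_mem (A := A) (Ideal.span (Set.range f))
  have h0 := boxIdeal_empty (maximalIdeal A) N (IsNoetherian.noetherian _)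
  rw [← h0] at hN ⊢
  have hc (s : Fin j) : ∃ c : (Fin j → MvPowerSeries (Fin j) A) →ₗ[MvPowerSeries (Fin j) A]
      MvPowerSeries (Fin j) A, X s ^ N s - c f ∈ boxIdeal (maximalIdeal A) N ∅ := by
    obtain ⟨x, hx, y, hy, hxy⟩ := Submodule.mem_sup.mp (hN s)
    obtain ⟨c, rfl⟩ := Ideal.mem_span_range_iff_exists_fun.mp hx
    refine ⟨Fintype.linearCombination _ c, ?_⟩
    rw [← hxy, Fintype.linearCombination_apply]
    simpa [mul_comm] using hy
  choose c hc using hc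
  let S (t : ℕ) : Set (Fin j) := {s | s < t}
  have hc' (s : Fin j) (T : Set (Fin j)) : X s ^ N s - c s f ∈ boxIdeal (maximalIdeal A) N T :=
    boxIdeal_mono _ _ (Set.empty_subset T) (hc s)
  have hS0 : S 0 = ∅ := by simp [S]
  have hJ (t : ℕ) (ht : t < j) : boxIdeal (maximalIdeal A) N (S (t + 1)) =
      boxIdeal (maximalIdeal A) N (S t) ⊔ Ideal.span {c ⟨t, ht⟩ f} := by
    have hS : S (t + 1) = insert ⟨t, ht⟩ (S t) := by
      ext s
      simp [S, Fin.ext_iff, le_iff_eq_or_lt]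
    rw [hS, boxIdeal_insert]
    have hx := hc' ⟨t, ht⟩ (S t)
    refine le_antisymm (sup_le le_sup_left ?_) (sup_le le_sup_left ?_) <;>
      rw [Ideal.span_singleton_le_iff_mem]
    · rw [← sub_add_cancel (X _ ^ _) (c ⟨t, ht⟩ f)]
      exact Submodule.add_mem_sup hx (Ideal.mem_span_singleton_self _)
    · rw [← sub_sub_cancel (X _ ^ _) (c ⟨t, ht⟩ f)]
      exact sub_mem (Ideal.mem_sup_right (Ideal.mem_span_singleton_self _))
        (Ideal.mem_sup_left hx)
  have hreg (t : ℕ) (ht : t < j) (a : MvPowerSeries (Fin j) A)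
      (ha : c ⟨t, ht⟩ f * a ∈ boxIdeal (maximalIdeal A) N (S t)) :
      a ∈ boxIdeal (maximalIdeal A) N (S t) := by
    have hs : (⟨t, ht⟩ : Fin j) ∉ S t := by simp [S]
    refine mem_boxIdeal_of_X_pow_mul_mem hs ?_
    have := add_mem (Ideal.mul_mem_right a _ (hc' ⟨t, ht⟩ (S t))) ha
    rwa [sub_mul, sub_add_cancel] at this
  rintro y ⟨hy, hy0⟩
  obtain ⟨r, rfl⟩ := Ideal.mem_span_range_iff_exists_fun.mp hy
  obtain ⟨g, hg, hg0⟩ := exists_apply_eq_of_regular f (fun t ↦ boxIdeal (maximalIdeal A) N (S t))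
    (fun t ↦ if h : t < j then c ⟨t, h⟩ else 0)
    (fun t ht ↦ by simpa only [dif_pos ht] using hJ t ht)
    (fun t ht a ha ↦ hreg t ht a (by simpa only [dif_pos ht] using ha))
    (Fintype.linearCombination _ r)
    (by simpa [hS0, Fintype.linearCombination_apply, mul_comm] using hy0)
  have hrg : ∑ i, r i * f i = g f := by
    rw [hg, Fintype.linearCombination_apply]
    simp [mul_comm]
  rw [hrg, ← hS0, LinearMap.pi_apply_eq_sum_univ]
  exact sum_mem fun i _ ↦ Ideal.mul_mem_mul (Ideal.subset_span ⟨i, rfl⟩) (hg0 _)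

theorem MvPowerSeries.finite_and_flat_quotient [IsPrecomplete (maximalIdeal A) A] :
    Module.Finite A (MvPowerSeries (Fin j) A ⧸ Ideal.span (Set.range f)) ∧
      Module.Flat A (MvPowerSeries (Fin j) A ⧸ Ideal.span (Set.range f)) := by
  have hf := finite_quotient (A := A) (Ideal.span (Set.range f))
  have := Module.finitePresentation_of_finite A
    (MvPowerSeries (Fin j) A ⧸ Ideal.span (Set.range f))
  have := Module.free_of_maximalIdeal_rTensor_injective
    ((maximalIdeal A).rTensor_subtype_quotient_injective _ (span_inf_map_maximalIdeal_le f))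
  exact ⟨hf, inferInstance⟩

end Fin

/-- Commutative algebra input for de Jong's trick: let `A` be a complete local
Noetherian ring and `B = A⟦X₁,…,X_j⟧/(f₁,…,f_j)` a quotient of the formal power
series ring by `j` elements such that `B ⊗_A k` is a finite-dimensional vector space
over the residue field `k` of `A`. Then `B` is finite and flat over `A`. -/
theorem deJong_finite_flat (A : Type*) [CommRing A] [IsLocalRing A] [IsNoetherianRing A]
    [IsAdicComplete (IsLocalRing.maximalIdeal A) A]
    (j : ℕ) (f : Fin j → MvPowerSeries (Fin j) A)
    (B : Type*) [CommRing B] [Algebra A B]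
    (e : (MvPowerSeries (Fin j) A ⧸ Ideal.span (Set.range f)) ≃ₐ[A] B)
    (hfin : Module.Finite (IsLocalRing.ResidueField A)
      (TensorProduct A (IsLocalRing.ResidueField A) B)) :
    Module.Finite A B ∧ Module.Flat A B := by
  let e' := e.symm.toLinearEquiv.baseChange A (IsLocalRing.ResidueField A) _ _
  have := Module.Finite.equiv e'
  obtain ⟨hf, hflat⟩ := MvPowerSeries.finite_and_flat_quotient f
  exact ⟨.equiv e.toLinearEquiv, .of_linearEquiv e.symm.toLinearEquiv⟩
end
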